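/- arXiv:1110.6014 — 2 statements merged into one kernel-verified Lean document; each statement's English description precedes it below -/
import Mathlib

section
/- Let g: ℂ → ℝ be a smooth function such that for every integer k ≥ 0 the C^k norm ‖g‖_{C^k(ℂ)} is finite (i.e. g and all its iterated partial derivatives are bounded on ℂ). Then there exists a smooth function φ: ℂ → ℝ such that −Δφ + φ = −g on ℂ, ‖φ‖_{C^k(ℂ)} < ∞ for every k ≥ 0, and sup_{z∈ℂ} |φ(z)| ≤ 4 · sup_{z∈ℂ} |g(z)|. -/
open Filter

/-- The Laplacian `∂²φ/∂x² + ∂²φ/∂y²` of a function `φ : ℂ → ℝ`,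
identifying `ℂ` with `ℝ²` via `z = x + iy`. -/
noncomputable def laplacian (φ : ℂ → ℝ) (z : ℂ) : ℝ :=
  iteratedFDeriv ℝ 2 φ z ![1, 1] + iteratedFDeriv ℝ 2 φ z ![Complex.I, Complex.I]

open MeasureTheory ProbabilityTheory Topology

section TranslationAverage

variable {E : Type*} [NormedAddCommGroup E]

lemma integrable_of_continuous_of_bounded {α : Type*} [TopologicalSpace α] [MeasurableSpace α]
    [OpensMeasurableSpace α] [SecondCountableTopologyEither α E]
    {μ : Measure α} [IsFiniteMeasure μ] {f : α → E} (hf : Continuous f) {C : ℝ}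
    (hC : ∀ x, ‖f x‖ ≤ C) : Integrable f μ :=
  .of_bound hf.aestronglyMeasurable C (.of_forall hC)

variable [NormedSpace ℝ E]

section

variable (μ : Measure ℂ) [IsProbabilityMeasure μ] {g : ℂ → E}

/-- Averaging a `C¹` function with bounded derivative over translations by a probability measure
commutes with differentiation. -/
lemma hasFDerivAt_integral_translate (hg : ContDiff ℝ 1 g) {C C' : ℝ} (hC : ∀ z, ‖g z‖ ≤ C)
    (hC' : ∀ z, ‖fderiv ℝ g z‖ ≤ C') (z : ℂ) :
    HasFDerivAt (fun z ↦ ∫ w, g (z + w) ∂μ) (∫ w, fderiv ℝ g (z + w) ∂μ) z := by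
  have hint (z : ℂ) : Integrable (fun w ↦ g (z + w)) μ :=
    integrable_of_continuous_of_bounded (hg.continuous.comp (by fun_prop)) fun w ↦ hC _
  refine hasFDerivAt_integral_of_dominated_of_fderiv_le
    (F' := fun z w ↦ fderiv ℝ g (z + w)) (bound := fun _ ↦ C') Filter.univ_mem
    (.of_forall fun z ↦ (hint z).aestronglyMeasurable) (hint z)
    ((hg.continuous_fderiv one_ne_zero).comp (by fun_prop)).aestronglyMeasurable
    (.of_forall fun w z _ ↦ hC' _) (integrable_const _) (.of_forall fun w z _ ↦ ?_)
  rw [hasFDerivAt_comp_add_right]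
  exact (hg.differentiable one_ne_zero _).hasFDerivAt

lemma hasFDerivAt_integral_translate_of_contDiff_infty (hg : ContDiff ℝ (⊤ : ℕ∞) g)
    (hgk : ∀ k : ℕ, ∃ C : ℝ, ∀ z : ℂ, ‖iteratedFDeriv ℝ k g z‖ ≤ C) (z : ℂ) :
    HasFDerivAt (fun z ↦ ∫ w, g (z + w) ∂μ) (∫ w, fderiv ℝ g (z + w) ∂μ) z := by
  obtain ⟨C₀, hC₀⟩ := hgk 0
  obtain ⟨C₁, hC₁⟩ := hgk 1
  simp only [norm_iteratedFDeriv_zero] at hC₀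
  simp only [norm_iteratedFDeriv_one] at hC₁
  have hg1 : ContDiff ℝ 1 g := hg.of_le (WithTop.coe_le_coe.2 (le_top (a := (1 : ℕ∞))))
  exact hasFDerivAt_integral_translate μ hg1 hC₀ hC₁ z

lemma exists_norm_iteratedFDeriv_fderiv_le
    (hgk : ∀ k : ℕ, ∃ C : ℝ, ∀ z : ℂ, ‖iteratedFDeriv ℝ k g z‖ ≤ C) (k : ℕ) :
    ∃ C : ℝ, ∀ z : ℂ, ‖iteratedFDeriv ℝ k (fderiv ℝ g) z‖ ≤ C := by
  obtain ⟨C, hC⟩ := hgk (k + 1)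
  exact ⟨C, fun z ↦ by rw [norm_iteratedFDeriv_fderiv]; exact hC z⟩

lemma contDiff_integral_translate [CompleteSpace E]
    (hg : ContDiff ℝ (⊤ : ℕ∞) g)
    (hgk : ∀ k : ℕ, ∃ C : ℝ, ∀ z : ℂ, ‖iteratedFDeriv ℝ k g z‖ ≤ C) (n : ℕ) :
    ContDiff ℝ n fun z ↦ ∫ w, g (z + w) ∂μ := by
  induction n generalizing E with
  | zero =>
    exact contDiff_zero.2 (continuous_iff_continuousAt.2 fun z ↦
      (hasFDerivAt_integral_translate_of_contDiff_infty μ hg hgk z).continuousAt)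
  | succ n ih =>
    have hd := hasFDerivAt_integral_translate_of_contDiff_infty μ hg hgk
    push_cast
    refine contDiff_succ_iff_fderiv.2 ⟨fun z ↦ (hd z).differentiableAt, by simp, ?_⟩
    rw [funext fun z ↦ (hd z).fderiv]
    exact ih (contDiff_infty_iff_fderiv.1 hg).2 (exists_norm_iteratedFDeriv_fderiv_le hgk)

lemma norm_iteratedFDeriv_integral_translate_le [CompleteSpace E]
    (hg : ContDiff ℝ (⊤ : ℕ∞) g)
    (hgk : ∀ k : ℕ, ∃ C : ℝ, ∀ z : ℂ, ‖iteratedFDeriv ℝ k g z‖ ≤ C) {k : ℕ} {C : ℝ}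
    (hC : ∀ z, ‖iteratedFDeriv ℝ k g z‖ ≤ C) (z : ℂ) :
    ‖iteratedFDeriv ℝ k (fun z ↦ ∫ w, g (z + w) ∂μ) z‖ ≤ C := by
  induction k generalizing E with
  | zero =>
    simp only [norm_iteratedFDeriv_zero] at hC ⊢
    simpa using norm_integral_le_of_norm_le_const (μ := μ) (.of_forall fun w ↦ hC (z + w))
  | succ k ih =>
    have hd := hasFDerivAt_integral_translate_of_contDiff_infty μ hg hgk
    rw [← norm_iteratedFDeriv_fderiv, funext fun z ↦ (hd z).fderiv]
    exact ih (contDiff_infty_iff_fderiv.1 hg).2 (exists_norm_iteratedFDeriv_fderiv_le hgk)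
      fun z ↦ by rw [norm_iteratedFDeriv_fderiv]; exact hC z

lemma integrable_fderiv_translate (hg : ContDiff ℝ (⊤ : ℕ∞) g)
    (hgk : ∀ k : ℕ, ∃ C : ℝ, ∀ z : ℂ, ‖iteratedFDeriv ℝ k g z‖ ≤ C) (z : ℂ) :
    Integrable (fun w ↦ fderiv ℝ g (z + w)) μ := by
  obtain ⟨C, hC⟩ := hgk 1
  simp only [norm_iteratedFDeriv_one] at hC
  exact integrable_of_continuous_of_bounded
    ((contDiff_infty_iff_fderiv.1 hg).2.continuous.comp (by fun_prop)) fun w ↦ hC (z + w)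

lemma fderiv_integral_translate_apply [CompleteSpace E]
    (hg : ContDiff ℝ (⊤ : ℕ∞) g)
    (hgk : ∀ k : ℕ, ∃ C : ℝ, ∀ z : ℂ, ‖iteratedFDeriv ℝ k g z‖ ≤ C) (z v : ℂ) :
    fderiv ℝ (fun z ↦ ∫ w, g (z + w) ∂μ) z v = ∫ w, fderiv ℝ g (z + w) v ∂μ := by
  rw [(hasFDerivAt_integral_translate_of_contDiff_infty μ hg hgk z).fderiv,
    ContinuousLinearMap.integral_apply (integrable_fderiv_translate μ hg hgk z)]

lemma iteratedFDeriv_two_integral_translate_apply [CompleteSpace E]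
    (hg : ContDiff ℝ (⊤ : ℕ∞) g)
    (hgk : ∀ k : ℕ, ∃ C : ℝ, ∀ z : ℂ, ‖iteratedFDeriv ℝ k g z‖ ≤ C) (z : ℂ)
    (v : Fin 2 → ℂ) :
    iteratedFDeriv ℝ 2 (fun z ↦ ∫ w, g (z + w) ∂μ) z v
      = ∫ w, iteratedFDeriv ℝ 2 g (z + w) v ∂μ := by
  have hg' := (contDiff_infty_iff_fderiv.1 hg).2
  have hgk' := exists_norm_iteratedFDeriv_fderiv_le hgk
  simp only [iteratedFDeriv_two_apply]
  rw [funext fun z ↦ (hasFDerivAt_integral_translate_of_contDiff_infty μ hg hgk z).fderiv,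
    fderiv_integral_translate_apply μ hg' hgk',
    ContinuousLinearMap.integral_apply
      ((integrable_fderiv_translate μ hg' hgk' z).apply_continuousLinearMap (v 0))]

end

end TranslationAverage

/-- Gaussian integration by parts. -/
lemma integral_id_mul_gaussianReal {f f' : ℝ → ℝ} (hf : ∀ x, HasDerivAt f (f' x) x)
    (hf' : Continuous f') {C C' : ℝ} (hC : ∀ x, ‖f x‖ ≤ C) (hC' : ∀ x, ‖f' x‖ ≤ C') :
    ∫ x, x * f x ∂(gaussianReal 0 1) = ∫ x, f' x ∂(gaussianReal 0 1) := by
  have hp (x : ℝ) : HasDerivAt (gaussianPDFReal 0 1) (-x * gaussianPDFReal 0 1 x) x := by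
    have h : HasDerivAt (fun x : ℝ ↦ -(x - 0) ^ 2 / (2 * ((1 : NNReal) : ℝ))) (-x) x := by
      refine ((((hasDerivAt_id x).sub_const 0).pow 2).neg.div_const
        (2 * ((1 : NNReal) : ℝ))).congr_deriv ?_
      simp only [id, sub_zero, NNReal.coe_one]
      ring
    refine (h.exp.const_mul (√(2 * Real.pi * ((1 : NNReal) : ℝ)))⁻¹).congr_deriv ?_
    rw [gaussianPDFReal_def]
    ring
  have hfc : Continuous f := continuous_iff_continuousAt.2 fun x ↦ (hf x).continuousAt
  have hxp : Integrable (fun x : ℝ ↦ -x * gaussianPDFReal 0 1 x) := by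
    have := (integrable_mul_exp_neg_mul_sq (b := 1 / 2) (by norm_num)).const_mul
      (-(√(2 * Real.pi * ((1 : NNReal) : ℝ)))⁻¹)
    refine this.congr (.of_forall fun x ↦ ?_)
    simp only [gaussianPDFReal, NNReal.coe_one, sub_zero, mul_one]
    rw [show -(1 / 2) * x ^ 2 = -x ^ 2 / 2 by ring]
    ring
  have h := integral_mul_deriv_eq_deriv_mul_of_integrable (u := f) (u' := f')
    (fun x _ ↦ hf x) (fun x _ ↦ hp x)
    (hxp.bdd_mul hfc.aestronglyMeasurable (.of_forall hC))
    ((integrable_gaussianPDFReal 0 1).bdd_mul hf'.aestronglyMeasurable (.of_forall hC'))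
    ((integrable_gaussianPDFReal 0 1).bdd_mul hfc.aestronglyMeasurable (.of_forall hC))
  simp only [integral_gaussianReal_eq_integral_smul one_ne_zero, smul_eq_mul]
  calc ∫ x, gaussianPDFReal 0 1 x * (x * f x)
      = -∫ x, f x * (-x * gaussianPDFReal 0 1 x) := by
        rw [← integral_neg]
        congr with x
        ring
    _ = ∫ x, gaussianPDFReal 0 1 x * f' x := by
        rw [h, neg_neg]
        simp only [mul_comm]

lemma integral_expMeasure_one (f : ℝ → ℝ) :
    ∫ t, f t ∂(expMeasure 1) = ∫ t in Set.Ioi 0, Real.exp (-t) * f t := by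
  have h : expMeasure 1 = volume.withDensity (exponentialPDF 1) := rfl
  have hm : Measurable (exponentialPDF 1) := (measurable_exponentialPDFReal 1).ennreal_ofReal
  rw [h, integral_withDensity_eq_integral_toReal_smul hm
    (.of_forall fun _ ↦ by simp [exponentialPDF]),
    ← integral_Ici_eq_integral_Ioi, ← integral_indicator measurableSet_Ici]
  congr with t
  by_cases ht : 0 ≤ t
  · simp [exponentialPDF_eq, ht, (Real.exp_pos _).le]
  · simp [exponentialPDF_eq, ht]

/-- The standard Gaussian measure on `ℝ × ℝ`. -/
noncomputable abbrev gaussianPlane : Measure (ℝ × ℝ) :=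
  (gaussianReal 0 1).prod (gaussianReal 0 1)

/-- The point `s (x + i y)` of the complex plane. -/
noncomputable def scaledPoint (s : ℝ) (w : ℝ × ℝ) : ℂ := s • (w.1 • (1 : ℂ) + w.2 • Complex.I)

@[fun_prop]
lemma continuous_scaledPoint : Continuous fun p : ℝ × ℝ × ℝ ↦ scaledPoint p.1 p.2 := by
  unfold scaledPoint
  fun_prop

lemma continuous_scaledPoint_right (s : ℝ) : Continuous (scaledPoint s) :=
  continuous_scaledPoint.comp (by fun_prop : Continuous fun w : ℝ × ℝ ↦ (s, w))

lemma continuous_scaledPoint_left (w : ℝ × ℝ) : Continuous fun s ↦ scaledPoint s w :=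
  continuous_scaledPoint.comp (by fun_prop : Continuous fun s : ℝ ↦ (s, w))

lemma integrable_fst_gaussianPlane : Integrable (fun w : ℝ × ℝ ↦ w.1) gaussianPlane :=
  ((memLp_id_gaussianReal 1).integrable le_rfl).comp_fst _

lemma integrable_snd_gaussianPlane : Integrable (fun w : ℝ × ℝ ↦ w.2) gaussianPlane :=
  ((memLp_id_gaussianReal 1).integrable le_rfl).comp_snd _

section PlaneIntegrationByParts

variable {u : ℂ → ℝ} {C C' : ℝ}

lemma integral_fst_mul_gaussianPlane (hu : ContDiff ℝ 1 u) (hC : ∀ z, ‖u z‖ ≤ C)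
    (hC' : ∀ z, ‖fderiv ℝ u z‖ ≤ C') (s : ℝ) :
    ∫ w, w.1 * u (scaledPoint s w) ∂gaussianPlane
      = s * ∫ w, fderiv ℝ u (scaledPoint s w) 1 ∂gaussianPlane := by
  have hu' : Continuous fun z ↦ fderiv ℝ u z 1 :=
    (hu.continuous_fderiv one_ne_zero).clm_apply continuous_const
  have hb (z : ℂ) : ‖fderiv ℝ u z 1‖ ≤ C' := by
    simpa using ((fderiv ℝ u z).le_opNorm 1).trans (by simpa using hC' z)
  rw [← integral_const_mul, integral_prod_symm, integral_prod_symm]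
  · congr with y
    refine integral_id_mul_gaussianReal (C := C) (C' := |s| * C') (fun x ↦ ?_) ?_
      (fun x ↦ hC _) (fun x ↦ ?_)
    · have h1 : HasDerivAt (fun x ↦ scaledPoint s (x, y)) (s • (1 : ℂ)) x := by
        unfold scaledPoint
        have := (((hasDerivAt_id x).smul_const (1 : ℂ)).add_const (y • Complex.I)).const_smul s
        rwa [one_smul] at this
      have := ((hu.differentiable one_ne_zero _).hasFDerivAt).comp_hasDerivAt x h1
      rwa [map_smul, smul_eq_mul] at this
    · exact continuous_const.mul
        (hu'.comp ((continuous_scaledPoint_right s).comp (by fun_prop)))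
    · rw [norm_mul, Real.norm_eq_abs]
      exact mul_le_mul_of_nonneg_left (hb _) (abs_nonneg s)
  · exact (integrable_of_continuous_of_bounded (hu'.comp (continuous_scaledPoint_right s))
      fun w ↦ hb _).const_mul s
  · exact integrable_fst_gaussianPlane.mul_bdd (c := C)
      (hu.continuous.comp (continuous_scaledPoint_right s)).aestronglyMeasurable
      (.of_forall fun w ↦ hC _)

lemma integral_snd_mul_gaussianPlane (hu : ContDiff ℝ 1 u) (hC : ∀ z, ‖u z‖ ≤ C)
    (hC' : ∀ z, ‖fderiv ℝ u z‖ ≤ C') (s : ℝ) :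
    ∫ w, w.2 * u (scaledPoint s w) ∂gaussianPlane
      = s * ∫ w, fderiv ℝ u (scaledPoint s w) Complex.I ∂gaussianPlane := by
  have hu' : Continuous fun z ↦ fderiv ℝ u z Complex.I :=
    (hu.continuous_fderiv one_ne_zero).clm_apply continuous_const
  have hb (z : ℂ) : ‖fderiv ℝ u z Complex.I‖ ≤ C' := by
    simpa using ((fderiv ℝ u z).le_opNorm Complex.I).trans (by simpa using hC' z)
  rw [← integral_const_mul, integral_prod, integral_prod]
  · congr with x
    refine integral_id_mul_gaussianReal (C := C) (C' := |s| * C') (fun y ↦ ?_) ?_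
      (fun y ↦ hC _) (fun y ↦ ?_)
    · have h1 : HasDerivAt (fun y ↦ scaledPoint s (x, y)) (s • Complex.I) y := by
        unfold scaledPoint
        have := (((hasDerivAt_id y).smul_const Complex.I).const_add (x • (1 : ℂ))).const_smul s
        rwa [one_smul] at this
      have := ((hu.differentiable one_ne_zero _).hasFDerivAt).comp_hasDerivAt y h1
      rwa [map_smul, smul_eq_mul] at this
    · exact continuous_const.mul
        (hu'.comp ((continuous_scaledPoint_right s).comp (by fun_prop)))
    · rw [norm_mul, Real.norm_eq_abs]
      exact mul_le_mul_of_nonneg_left (hb _) (abs_nonneg s)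
  · exact (integrable_of_continuous_of_bounded (hu'.comp (continuous_scaledPoint_right s))
      fun w ↦ hb _).const_mul s
  · exact integrable_snd_gaussianPlane.mul_bdd (c := C)
      (hu.continuous.comp (continuous_scaledPoint_right s)).aestronglyMeasurable
      (.of_forall fun w ↦ hC _)

end PlaneIntegrationByParts

section Laplacian

variable {h : ℂ → ℝ}

lemma laplacian_eq_fderiv (hh : ContDiff ℝ 2 h) (z : ℂ) :
    laplacian h z = fderiv ℝ (fun z ↦ fderiv ℝ h z 1) z 1
      + fderiv ℝ (fun z ↦ fderiv ℝ h z Complex.I) z Complex.I := by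
  have hd : DifferentiableAt ℝ (fderiv ℝ h) z :=
    (hh.fderiv_right (m := 1) (by norm_num)).differentiable one_ne_zero z
  simp [laplacian, iteratedFDeriv_two_apply, fderiv_clm_apply hd (differentiableAt_const _)]

lemma continuous_laplacian (hh : ContDiff ℝ 2 h) : Continuous (laplacian h) := by
  have hc := hh.continuous_iteratedFDeriv (m := 2) le_rfl
  unfold laplacian
  fun_prop

lemma norm_laplacian_le {C : ℝ} (hC : ∀ z, ‖iteratedFDeriv ℝ 2 h z‖ ≤ C) (z : ℂ) :
    ‖laplacian h z‖ ≤ C + C := by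
  refine (norm_add_le _ _).trans (add_le_add ?_ ?_)
  all_goals
    refine (ContinuousMultilinearMap.le_opNorm _ _).trans ?_
    simpa [Fin.prod_univ_two] using hC z

/-- The heat equation for Gaussian averages, parametrized by the standard deviation. -/
lemma hasDerivAt_integral_gaussianPlane (hh : ContDiff ℝ 2 h)
    (hhk : ∀ k : ℕ, ∃ C : ℝ, ∀ z : ℂ, ‖iteratedFDeriv ℝ k h z‖ ≤ C) (s : ℝ) :
    HasDerivAt (fun s ↦ ∫ w, h (scaledPoint s w) ∂gaussianPlane)
      (s * ∫ w, laplacian h (scaledPoint s w) ∂gaussianPlane) s := by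
  obtain ⟨C₀, hC₀⟩ := hhk 0
  obtain ⟨C₁, hC₁⟩ := hhk 1
  obtain ⟨C₂, hC₂⟩ := hhk 2
  simp only [norm_iteratedFDeriv_zero] at hC₀
  simp only [norm_iteratedFDeriv_one] at hC₁
  have hcd : ContDiff ℝ 1 (fderiv ℝ h) := hh.fderiv_right (by norm_num)
  have hu (v : ℂ) : ContDiff ℝ 1 fun z ↦ fderiv ℝ h z v := hcd.clm_apply contDiff_const
  have hub (v : ℂ) (hv : ‖v‖ = 1) (z : ℂ) : ‖fderiv ℝ h z v‖ ≤ C₁ := by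
    simpa [hv] using ((fderiv ℝ h z).le_opNorm v).trans (by simpa [hv] using hC₁ z)
  have hub' (v : ℂ) (hv : ‖v‖ = 1) (z : ℂ) :
      ‖fderiv ℝ (fun z ↦ fderiv ℝ h z v) z‖ ≤ C₂ := by
    have hd : DifferentiableAt ℝ (fderiv ℝ h) z := hcd.differentiable one_ne_zero z
    have h0 : 0 ≤ C₂ := (norm_nonneg _).trans (hC₂ 0)
    refine ContinuousLinearMap.opNorm_le_bound _ h0 fun a ↦ ?_
    have : fderiv ℝ (fun z ↦ fderiv ℝ h z v) z a = iteratedFDeriv ℝ 2 h z ![a, v] := by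
      simp [iteratedFDeriv_two_apply, fderiv_clm_apply hd (differentiableAt_const _)]
    rw [this]
    refine (ContinuousMultilinearMap.le_opNorm _ _).trans ?_
    simpa [Fin.prod_univ_two, hv] using mul_le_mul_of_nonneg_right (hC₂ z) (norm_nonneg a)
  let F' : ℝ → ℝ × ℝ → ℝ := fun s w ↦ w.1 * fderiv ℝ h (scaledPoint s w) 1
    + w.2 * fderiv ℝ h (scaledPoint s w) Complex.I
  have hint (v : ℂ) (hv : ‖v‖ = 1) (s : ℝ) {p : ℝ × ℝ → ℝ} (hp : Integrable p gaussianPlane) :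
      Integrable (fun w ↦ p w * fderiv ℝ h (scaledPoint s w) v) gaussianPlane :=
    hp.mul_bdd (c := C₁)
      ((hu v).continuous.comp (continuous_scaledPoint_right s)).aestronglyMeasurable
      (.of_forall fun w ↦ hub v hv _)
  have hint1 := hint 1 (by simp) s integrable_fst_gaussianPlane
  have hintI := hint Complex.I (by simp) s integrable_snd_gaussianPlane
  have hval : s * ∫ w, laplacian h (scaledPoint s w) ∂gaussianPlane
      = ∫ w, F' s w ∂gaussianPlane := by
    have hint2 (v : ℂ) (hv : ‖v‖ = 1) : Integrable
        (fun w ↦ fderiv ℝ (fun z ↦ fderiv ℝ h z v) (scaledPoint s w) v) gaussianPlane := by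
      refine integrable_of_continuous_of_bounded (C := C₂)
        ((((hu v).continuous_fderiv one_ne_zero).clm_apply continuous_const).comp
          (continuous_scaledPoint_right s)) fun w ↦ ?_
      simpa only [hv, mul_one] using (ContinuousLinearMap.le_opNorm _ v).trans
        (by simpa [hv] using hub' v hv (scaledPoint s w))
    simp only [F', laplacian_eq_fderiv hh]
    rw [integral_add hint1 hintI, integral_add (hint2 1 (by simp)) (hint2 _ (by simp)), mul_add,
      integral_fst_mul_gaussianPlane (hu 1) (hub 1 (by simp)) (hub' 1 (by simp)),
      integral_snd_mul_gaussianPlane (hu _) (hub _ (by simp)) (hub' _ (by simp))]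
  rw [hval]
  refine (hasDerivAt_integral_of_dominated_loc_of_deriv_le (F' := F')
    (bound := fun w ↦ ‖w.1‖ * C₁ + ‖w.2‖ * C₁) Filter.univ_mem
    (.of_forall fun s ↦
      (hh.continuous.comp (continuous_scaledPoint_right s)).aestronglyMeasurable)
    (integrable_of_continuous_of_bounded (hh.continuous.comp (continuous_scaledPoint_right s))
      fun w ↦ hC₀ _)
    (hint1.add hintI).aestronglyMeasurable (.of_forall fun w s _ ↦ ?_)
    ((integrable_fst_gaussianPlane.norm.mul_const C₁).add
      (integrable_snd_gaussianPlane.norm.mul_const C₁)) (.of_forall fun w s _ ↦ ?_)).2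
  · refine (norm_add_le _ _).trans ?_
    rw [norm_mul, norm_mul]
    gcongr
    · exact hub _ (by simp) _
    · exact hub _ (by simp) _
  · have h1 : HasDerivAt (fun s ↦ scaledPoint s w) (w.1 • (1 : ℂ) + w.2 • Complex.I) s := by
      unfold scaledPoint
      simpa using (hasDerivAt_id s).smul_const (w.1 • (1 : ℂ) + w.2 • Complex.I)
    have := ((hh.differentiable two_ne_zero _).hasFDerivAt).comp_hasDerivAt s h1
    rwa [map_add, map_smul, map_smul, smul_eq_mul, smul_eq_mul] at this

/-- The law of a complex Gaussian with exponentially distributed variance, whose density is the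
fundamental solution of `1 - Δ`. -/
noncomputable def resolventMeasure : Measure ℂ :=
  ((expMeasure 1).prod gaussianPlane).map fun p ↦ scaledPoint √(2 * p.1) p.2

lemma continuous_resolventMeasure_map :
    Continuous fun p : ℝ × ℝ × ℝ ↦ scaledPoint √(2 * p.1) p.2 :=
  continuous_scaledPoint.comp (by fun_prop : Continuous fun p : ℝ × ℝ × ℝ ↦ (√(2 * p.1), p.2))

instance : IsProbabilityMeasure (expMeasure 1) := isProbabilityMeasure_expMeasure one_pos

instance : IsProbabilityMeasure resolventMeasure :=
  Measure.isProbabilityMeasure_map continuous_resolventMeasure_map.aemeasurable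

lemma integral_resolventMeasure {f : ℂ → ℝ} (hf : Continuous f) {C : ℝ}
    (hC : ∀ z, ‖f z‖ ≤ C) :
    ∫ z, f z ∂resolventMeasure
      = ∫ t in Set.Ioi 0, Real.exp (-t) * ∫ w, f (scaledPoint √(2 * t) w) ∂gaussianPlane := by
  rw [resolventMeasure, integral_map continuous_resolventMeasure_map.aemeasurable
    hf.aestronglyMeasurable, integral_prod, integral_expMeasure_one]
  exact integrable_of_continuous_of_bounded (hf.comp continuous_resolventMeasure_map)
    fun p ↦ hC _

/-- The measure `resolventMeasure` is a fundamental solution of `1 - Δ`. -/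
lemma integral_sub_laplacian_resolventMeasure (hh : ContDiff ℝ 2 h)
    (hhk : ∀ k : ℕ, ∃ C : ℝ, ∀ z : ℂ, ‖iteratedFDeriv ℝ k h z‖ ≤ C) :
    ∫ z, h z ∂resolventMeasure - ∫ z, laplacian h z ∂resolventMeasure = h 0 := by
  obtain ⟨C₀, hC₀⟩ := hhk 0
  obtain ⟨C₂, hC₂⟩ := hhk 2
  simp only [norm_iteratedFDeriv_zero] at hC₀
  let A (f : ℂ → ℝ) (s : ℝ) : ℝ := ∫ w, f (scaledPoint s w) ∂gaussianPlane
  have hAb {f : ℂ → ℝ} {C : ℝ} (hC : ∀ z, ‖f z‖ ≤ C) (s : ℝ) : ‖A f s‖ ≤ C := by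
    simpa using norm_integral_le_of_norm_le_const (μ := gaussianPlane)
      (.of_forall fun w ↦ hC (scaledPoint s w))
  have hAc {f : ℂ → ℝ} (hf : Continuous f) {C : ℝ} (hC : ∀ z, ‖f z‖ ≤ C) :
      Continuous (A f) :=
    continuous_of_dominated
      (fun s ↦ (hf.comp (continuous_scaledPoint_right s)).aestronglyMeasurable)
      (fun s ↦ .of_forall fun w ↦ hC _) (integrable_const C)
      (.of_forall fun w ↦ hf.comp (continuous_scaledPoint_left w))
  have hexp : IntegrableOn (fun t : ℝ ↦ Real.exp (-t)) (Set.Ioi 0) := integrableOn_exp_neg_Ioi 0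
  have hsqrt : Continuous fun t : ℝ ↦ √(2 * t) := by fun_prop
  have hint {f : ℂ → ℝ} (hf : Continuous f) {C : ℝ} (hC : ∀ z, ‖f z‖ ≤ C) :
      IntegrableOn (fun t : ℝ ↦ Real.exp (-t) * A f √(2 * t)) (Set.Ioi 0) :=
    hexp.mul_bdd (c := C) ((hAc hf hC).comp hsqrt).aestronglyMeasurable
      (.of_forall fun t ↦ hAb hC _)
  have hlc := continuous_laplacian hh
  have hlb := norm_laplacian_le hC₂
  have hderiv (t : ℝ) (ht : t ∈ Set.Ioi (0 : ℝ)) :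
      HasDerivAt (fun t ↦ Real.exp (-t) * A h √(2 * t))
        (Real.exp (-t) * A (laplacian h) √(2 * t) - Real.exp (-t) * A h √(2 * t)) t := by
    have ht' : 0 < 2 * t := by simpa using ht
    have h1 : HasDerivAt (fun t : ℝ ↦ √(2 * t)) (1 / √(2 * t)) t := by
      refine (((hasDerivAt_id t).const_mul 2).sqrt ht'.ne').congr_deriv ?_
      simp only [id, mul_one]
      field_simp
    have h2 : HasDerivAt (fun t : ℝ ↦ Real.exp (-t)) (-Real.exp (-t)) t := by
      simpa using (hasDerivAt_neg t).exp
    have h3 := (hasDerivAt_integral_gaussianPlane hh hhk √(2 * t)).comp t h1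
    have hs : √(2 * t) ≠ 0 := (Real.sqrt_pos.2 ht').ne'
    have h4 : √(2 * t) * A (laplacian h) √(2 * t) * (1 / √(2 * t))
        = A (laplacian h) √(2 * t) := by field_simp
    refine (h2.mul h3).congr_deriv ?_
    change _ + Real.exp (-t) * (√(2 * t) * A (laplacian h) √(2 * t) * (1 / √(2 * t))) = _
    rw [h4]
    change -Real.exp (-t) * A h √(2 * t) + _ = _
    ring
  have hlim : Tendsto (fun t : ℝ ↦ Real.exp (-t) * A h √(2 * t)) atTop (𝓝 0) := by
    refine squeeze_zero_norm (a := fun t ↦ Real.exp (-t) * C₀) (fun t ↦ ?_) ?_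
    · rw [norm_mul, Real.norm_of_nonneg (Real.exp_pos _).le]
      exact mul_le_mul_of_nonneg_left (hAb hC₀ _) (Real.exp_pos _).le
    · simpa using Real.tendsto_exp_neg_atTop_nhds_zero.mul_const C₀
  have hG0 : Real.exp (-0) * A h √(2 * 0) = h 0 := by simp [A, scaledPoint]
  have key := integral_Ioi_of_hasDerivAt_of_tendsto (a := 0)
    ((by fun_prop : Continuous fun t : ℝ ↦ Real.exp (-t)).mul
      ((hAc hh.continuous hC₀).comp hsqrt)).continuousWithinAt
    hderiv ((hint hlc hlb).sub (hint hh.continuous hC₀)) hlim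
  rw [integral_sub (hint hlc hlb) (hint hh.continuous hC₀)] at key
  change _ = 0 - Real.exp (-0) * A h √(2 * 0) at key
  rw [hG0] at key
  rw [integral_resolventMeasure hh.continuous hC₀, integral_resolventMeasure hlc hlb]
  linarith

end Laplacian

theorem stmt_2 (g : ℂ → ℝ) (hg : ContDiff ℝ (⊤ : ℕ∞) g)
    (hgk : ∀ k : ℕ, ∃ C : ℝ, ∀ z : ℂ, ‖iteratedFDeriv ℝ k g z‖ ≤ C) :
    ∃ φ : ℂ → ℝ, ContDiff ℝ (⊤ : ℕ∞) φ ∧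
      (∀ z : ℂ, -laplacian φ z + φ z = -g z) ∧
      (∀ k : ℕ, ∃ C : ℝ, ∀ z : ℂ, ‖iteratedFDeriv ℝ k φ z‖ ≤ C) ∧
      (⨆ z : ℂ, |φ z|) ≤ 4 * ⨆ z : ℂ, |g z| := by
  have hnk (k : ℕ) : ∃ C : ℝ, ∀ z : ℂ, ‖iteratedFDeriv ℝ k (fun z ↦ -g z) z‖ ≤ C := by
    obtain ⟨C, hC⟩ := hgk k
    refine ⟨C, fun z ↦ ?_⟩
    rw [show (fun z ↦ -g z) = -g from rfl, iteratedFDeriv_neg_apply, norm_neg]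
    exact hC z
  have h_two : (2 : WithTop ℕ∞) ≤ (⊤ : ℕ∞) := WithTop.coe_le_coe.2 (le_top (a := (2 : ℕ∞)))
  have hn : ContDiff ℝ (⊤ : ℕ∞) fun z ↦ -g z := hg.neg
  refine ⟨fun z ↦ ∫ w, -g (z + w) ∂resolventMeasure,
    contDiff_infty.2 (contDiff_integral_translate resolventMeasure hn hnk),
    fun z ↦ ?_, fun k ↦ ?_, ?_⟩
  · have hshift (k : ℕ) (w : ℂ) : iteratedFDeriv ℝ k (fun w ↦ -g (z + w)) w
        = iteratedFDeriv ℝ k (fun w ↦ -g w) (z + w) :=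
      iteratedFDeriv_comp_add_left (f := fun w ↦ -g w) k z w
    have hs : ContDiff ℝ 2 fun w ↦ -g (z + w) :=
      (hn.comp (contDiff_const.add contDiff_id)).of_le h_two
    have hsk (k : ℕ) : ∃ C : ℝ, ∀ w : ℂ, ‖iteratedFDeriv ℝ k (fun w ↦ -g (z + w)) w‖ ≤ C := by
      obtain ⟨C, hC⟩ := hnk k
      exact ⟨C, fun w ↦ by rw [hshift]; exact hC _⟩
    have key := integral_sub_laplacian_resolventMeasure hs hsk
    have hlap : laplacian (fun z ↦ ∫ w, -g (z + w) ∂resolventMeasure) z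
        = ∫ w, laplacian (fun w ↦ -g (z + w)) w ∂resolventMeasure := by
      obtain ⟨C, hC⟩ := hnk 2
      have hint : Integrable (fun w ↦ iteratedFDeriv ℝ 2 (fun w ↦ -g w) (z + w))
          resolventMeasure :=
        integrable_of_continuous_of_bounded
          ((hn.continuous_iteratedFDeriv (m := 2) h_two).comp
            (by fun_prop)) fun w ↦ hC _
      have hiapp (v : Fin 2 → ℂ) :=
        (ContinuousMultilinearMap.apply ℝ (fun _ : Fin 2 ↦ ℂ) ℝ v).integrable_comp hint
      simp only [ContinuousMultilinearMap.apply_apply] at hiapp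
      simp only [laplacian, hshift]
      rw [integral_add (hiapp _) (hiapp _),
        iteratedFDeriv_two_integral_translate_apply resolventMeasure hn hnk,
        iteratedFDeriv_two_integral_translate_apply resolventMeasure hn hnk]
    rw [add_zero] at key
    rw [hlap]
    linarith
  · obtain ⟨C, hC⟩ := hnk k
    exact ⟨C, norm_iteratedFDeriv_integral_translate_le resolventMeasure hn hnk hC⟩
  · obtain ⟨C, hC⟩ := hgk 0
    simp only [norm_iteratedFDeriv_zero, Real.norm_eq_abs] at hC
    have hle (z : ℂ) : |g z| ≤ ⨆ z : ℂ, |g z| := le_ciSup ⟨C, by rintro _ ⟨z, rfl⟩; exact hC z⟩ z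
    have h0 : 0 ≤ ⨆ z : ℂ, |g z| := (abs_nonneg _).trans (hle 0)
    refine ciSup_le fun z ↦ ?_
    have : |∫ w, -g (z + w) ∂resolventMeasure| ≤ ⨆ z : ℂ, |g z| := by
      simpa using norm_integral_le_of_norm_le_const (μ := resolventMeasure)
        (f := fun w ↦ -g (z + w)) (C := ⨆ z : ℂ, |g z|)
        (.of_forall fun w ↦ by simpa using hle (z + w))
    linarith
end

section
/- Let h be a map from the collection of bounded Borel subsets of ℂ to ℝ_{≥0} satisfying: (i) if Ω₁ ⊆ Ω₂ then h(Ω₁) ≤ h(Ω₂); (ii) h(Ω₁ ∪ Ω₂) ≤ h(Ω₁) + h(Ω₂); (iii) h(a + Ω) = h(Ω) for every a ∈ ℂ and every bounded Borel set Ω, where a + Ω := {a + z : z ∈ Ω}. Then for every Følner sequence (Ω_n)_{n≥1} in ℂ, the limit of h(Ω_n)/area(Ω_n) as n → ∞ exists; moreover, if (Ω_n) and (Ω'_n) are two Følner sequences, then lim_{n→∞} h(Ω_n)/area(Ω_n) = lim_{n→∞} h(Ω'_n)/area(Ω'_n). -/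
open Filter MeasureTheory

/-- For `Ω ⊆ ℂ` and `r > 0`, `∂_r Ω` is the set of `a ∈ ℂ` such that the closed disk
`D_r(a)` meets both `Ω` and its complement. -/
def rBoundary (r : ℝ) (Ω : Set ℂ) : Set ℂ :=
  {a : ℂ | (Metric.closedBall a r ∩ Ω).Nonempty ∧ (Metric.closedBall a r ∩ Ωᶜ).Nonempty}

/-- A Følner sequence in `ℂ`: a sequence of bounded Borel sets of positive area such that
for every `r > 0` the relative area of the `r`-boundary tends to `0`. -/
def IsFolner (Ω : ℕ → Set ℂ) : Prop :=
  (∀ n, Bornology.IsBounded (Ω n)) ∧ (∀ n, MeasurableSet (Ω n)) ∧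
  (∀ n, 0 < (volume (Ω n)).toReal) ∧
  ∀ r > (0:ℝ),
    Tendsto (fun n => (volume (rBoundary r (Ω n))).toReal / (volume (Ω n)).toReal)
      atTop (nhds 0)

section OrnsteinWeiss

variable {G : Type*} [AddCommGroup G] [DecidableEq G]

/-- The number of pairs `(a, g) ∈ A × K` such that the translate `a + g` leaves `A`. -/
def translateBoundary (K A : Finset G) : ℕ :=
  ∑ g ∈ K, (A.filter fun a => a + g ∉ A).card

lemma translateBoundary_empty (K : Finset G) : translateBoundary K ∅ = 0 := by
  simp [translateBoundary]

lemma translateBoundary_mono {K L : Finset G} (h : K ⊆ L) (A : Finset G) :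
    translateBoundary K A ≤ translateBoundary L A :=
  Finset.sum_le_sum_of_subset h

lemma translateBoundary_union_le (K A B : Finset G) :
    translateBoundary K (A ∪ B) ≤ translateBoundary K A + translateBoundary K B := by
  unfold translateBoundary
  rw [← Finset.sum_add_distrib]
  refine Finset.sum_le_sum fun g _ => ?_
  refine (Finset.card_le_card ?_).trans (Finset.card_union_le _ _)
  intro a
  simp only [Finset.mem_filter, Finset.mem_union]
  tauto

lemma card_filter_sub_notMem (B : Finset G) (g : G) :
    (B.filter fun x => x - g ∉ B).card = (B.filter fun x => x + g ∉ B).card := by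
  have h1 := Finset.card_filter_add_card_filter_not (s := B) (fun x => x - g ∈ B)
  have h2 := Finset.card_filter_add_card_filter_not (s := B) (fun x => x + g ∈ B)
  have h3 : (B.filter fun x => x - g ∈ B).card = (B.filter fun x => x + g ∈ B).card := by
    refine Finset.card_bij' (fun x _ => x - g) (fun x _ => x + g) ?_ ?_ ?_ ?_ <;>
      simp +contextual
  omega

lemma translateBoundary_sdiff_le (K A B : Finset G) :
    translateBoundary K (A \ B) ≤ translateBoundary K A + translateBoundary K B := by
  unfold translateBoundary
  rw [← Finset.sum_add_distrib]
  refine Finset.sum_le_sum fun g _ => ?_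
  rw [← card_filter_sub_notMem B g,
    ← Finset.card_image_of_injective (B.filter fun x => x - g ∉ B) (sub_left_injective (b := g))]
  refine (Finset.card_le_card ?_).trans (Finset.card_union_le _ _)
  intro a
  simp only [Finset.mem_filter, Finset.mem_union, Finset.mem_sdiff, Finset.mem_image]
  rintro ⟨⟨ha, hb⟩, hab⟩
  by_cases h : a + g ∈ A
  · exact Or.inr ⟨a + g, ⟨by tauto, by simpa using hb⟩, by simp⟩
  · exact Or.inl ⟨ha, h⟩

lemma translateBoundary_image_add (K T : Finset G) (c : G) :
    translateBoundary K (T.image (c + ·)) = translateBoundary K T := by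
  unfold translateBoundary
  refine Finset.sum_congr rfl fun g _ => ?_
  rw [Finset.filter_image, Finset.card_image_of_injective _ (add_right_injective c)]
  congr 1
  ext a
  simp [add_assoc]

/-- Most points of `R` are base points of translates of `T` contained in `R`. -/
lemma card_le_card_translates_add (R T : Finset G) :
    R.card ≤ (R.filter fun c => ∀ t ∈ T, c + t ∈ R).card + translateBoundary T R := by
  rw [← Finset.card_filter_add_card_filter_not (s := R) (fun c => ∀ t ∈ T, c + t ∈ R)]
  gcongr
  unfold translateBoundary
  refine le_trans (Finset.card_le_card ?_) Finset.card_biUnion_le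
  intro a
  simp only [Finset.mem_filter, Finset.mem_biUnion]
  push Not
  rintro ⟨ha, t, ht, h⟩
  exact ⟨t, ht, ha, h⟩

lemma card_union_image_add (B T : Finset G) (c : G) :
    (B ∪ T.image (c + ·)).card + (T.filter fun t => c + t ∈ B).card = B.card + T.card := by
  have h := Finset.card_union_add_card_inter B (T.image (c + ·))
  rw [Finset.card_image_of_injective _ (add_right_injective c)] at h
  rw [← h, Finset.inter_comm, ← Finset.filter_mem_eq_inter, Finset.filter_image,
    Finset.card_image_of_injective _ (add_right_injective c)]

/-- A set function on finite sets that is subadditive, translation invariant, and vanishes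
on the empty set. -/
structure IsInvSubadditive (H : Finset G → ℝ) : Prop where
  empty : H ∅ = 0
  union_le : ∀ A B, H (A ∪ B) ≤ H A + H B
  image_add : ∀ (c : G) A, H (A.image (c + ·)) = H A

lemma isInvSubadditive_translateBoundary (K : Finset G) :
    IsInvSubadditive fun A => (translateBoundary K A : ℝ) where
  empty := by simp [translateBoundary_empty]
  union_le A B := mod_cast translateBoundary_union_le K A B
  image_add c A := congrArg _ (translateBoundary_image_add K A c)

lemma IsInvSubadditive.le_card {H : Finset G → ℝ} (hH : IsInvSubadditive H) (A : Finset G) :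
    H A ≤ H {0} * A.card := by
  induction A using Finset.induction_on with
  | empty => simp [hH.empty]
  | insert a A ha ih =>
    rw [Finset.card_insert_of_notMem ha, Finset.insert_eq]
    have h1 := hH.union_le {a} A
    have h2 := hH.image_add a {0}
    simp only [Finset.image_singleton, add_zero] at h2
    push_cast
    linarith

/-- Greedy packing of almost disjoint translates of `T` in `R`. -/
lemma exists_almost_disjoint_translates (R T : Finset G) (hT : T.Nonempty) {ε : ℝ}
    (hε0 : 0 < ε) (hε1 : ε < 1) :
    ∃ B ⊆ R, ∃ m : ℕ, (1 - ε) * (m * T.card) ≤ B.card ∧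
      (∀ H : Finset G → ℝ, IsInvSubadditive H → H B ≤ m * H T) ∧
      ε * (R.card - translateBoundary T R) ≤ B.card := by
  classical
  let P : Finset G → Prop := fun B => ∃ m : ℕ, (1 - ε) * (m * T.card) ≤ B.card ∧
      (∀ H : Finset G → ℝ, IsInvSubadditive H → H B ≤ m * H T)
  have hP0 : P ∅ := ⟨0, by simp, fun H hH => by simp [hH.empty]⟩
  obtain ⟨B, hB, hmax⟩ := Finset.exists_max_image (R.powerset.filter P) Finset.card
    ⟨∅, by simp [hP0]⟩
  rw [Finset.mem_filter, Finset.mem_powerset] at hB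
  obtain ⟨hBR, m, hm, hmH⟩ := hB
  refine ⟨B, hBR, m, hm, hmH, ?_⟩
  have hTpos : (0 : ℝ) < T.card := mod_cast hT.card_pos
  set I := R.filter fun c => ∀ t ∈ T, c + t ∈ R with hI
  have hoverlap : ∀ c ∈ I, ε * T.card ≤ ((T.filter fun t => c + t ∈ B).card : ℝ) := by
    intro c hc
    rw [hI, Finset.mem_filter] at hc
    by_contra! hlt
    have hcard : ((B ∪ T.image (c + ·)).card : ℝ) + (T.filter fun t => c + t ∈ B).card
        = B.card + T.card := mod_cast card_union_image_add B T c
    have hmem : B ∪ T.image (c + ·) ∈ R.powerset.filter P := by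
      rw [Finset.mem_filter, Finset.mem_powerset]
      refine ⟨Finset.union_subset hBR (Finset.image_subset_iff.2 hc.2), m + 1, ?_, ?_⟩
      · push_cast
        linarith
      · intro H hH
        have h1 := hH.union_le B (T.image (c + ·))
        rw [hH.image_add] at h1
        have h2 := hmH H hH
        push_cast
        linarith
    have hle : ((B ∪ T.image (c + ·)).card : ℝ) ≤ B.card := mod_cast hmax _ hmem
    nlinarith
  have hcount : ∑ c ∈ I, (T.filter fun t => c + t ∈ B).card ≤ T.card * B.card := by
    simp only [Finset.card_filter]
    rw [Finset.sum_comm, ← smul_eq_mul]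
    refine Finset.sum_le_card_nsmul _ _ _ fun t _ => ?_
    rw [← Finset.card_filter]
    refine Finset.card_le_card_of_injOn (· + t) (fun c hc => ?_) (add_left_injective t).injOn
    simp only [Finset.coe_filter, Set.mem_ofPred_eq] at hc
    exact hc.2
  have hsum : (I.card : ℝ) * (ε * T.card) ≤ T.card * B.card := by
    rw [← nsmul_eq_mul]
    refine (Finset.card_nsmul_le_sum _ _ _ hoverlap).trans ?_
    exact_mod_cast hcount
  have hIB : ε * I.card ≤ B.card := by
    refine le_of_mul_le_mul_left ?_ hTpos
    linarith
  have hRI : (R.card : ℝ) ≤ I.card + translateBoundary T R :=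
    mod_cast card_le_card_translates_add R T
  refine le_trans ?_ hIB
  gcongr
  linarith

/-- Ornstein–Weiss quasi-tilings: every sufficiently invariant finite set is covered, up to a
proportion `ρ`, by an invariant subset `B` with `H B ≤ β * #B`. -/
def HasQuasiTilings (H : Finset G → ℝ) (β ρ : ℝ) : Prop :=
  ∀ (K : Finset G) (δ : ℝ), 0 < δ → ∃ (L : Finset G) (η : ℝ), 0 < η ∧
    ∀ A : Finset G, translateBoundary L A ≤ η * A.card →
      ∃ B ⊆ A, H B ≤ β * B.card ∧ ((A \ B).card : ℝ) ≤ ρ * A.card ∧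
        translateBoundary K B ≤ δ * A.card

lemma HasQuasiTilings.refine {H : Finset G → ℝ} (hH : IsInvSubadditive H) {α ε ρ : ℝ}
    (hα : 0 ≤ α) (hε0 : 0 < ε) (hε1 : ε < 1) (hρ : 0 < ρ)
    (htile : ∀ (K : Finset G) (δ : ℝ), 0 < δ → ∃ T : Finset G, T.Nonempty ∧
      translateBoundary K T ≤ δ * T.card ∧ H T ≤ α * T.card)
    (h : HasQuasiTilings H (α / (1 - ε)) ρ) :
    HasQuasiTilings H (α / (1 - ε)) ((1 - ε / 2) * ρ) := by
  intro K δ hδ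
  have hε' : 0 < 1 - ε := by linarith
  obtain ⟨T, hT, hTK, hTH⟩ := htile K (δ / 2 * (1 - ε)) (by positivity)
  set δ₁ := min (δ / 2) (ρ / 4)
  have hδ₁0 : 0 < δ₁ := by positivity
  obtain ⟨L, η, hη, hL⟩ := h (T ∪ K) δ₁ hδ₁0
  refine ⟨L ∪ (T ∪ K), min η δ₁, by positivity, fun A hA => ?_⟩
  have hAc : (0 : ℝ) ≤ A.card := by positivity
  have hAL : (translateBoundary L A : ℝ) ≤ η * A.card := by
    have h1 : (translateBoundary L A : ℝ) ≤ translateBoundary (L ∪ (T ∪ K)) A :=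
      mod_cast translateBoundary_mono Finset.subset_union_left A
    have h2 := mul_le_mul_of_nonneg_right (min_le_left η δ₁) hAc
    linarith
  have hAT : (translateBoundary T A : ℝ) ≤ δ₁ * A.card := by
    have h1 : (translateBoundary T A : ℝ) ≤ translateBoundary (L ∪ (T ∪ K)) A :=
      mod_cast translateBoundary_mono
        (Finset.subset_union_left.trans Finset.subset_union_right) A
    have h2 := mul_le_mul_of_nonneg_right (min_le_right η δ₁) hAc
    linarith
  obtain ⟨B₁, hB₁A, hB₁H, hB₁c, hB₁K⟩ := hL A hAL
  have hB₁T : (translateBoundary T B₁ : ℝ) ≤ δ₁ * A.card :=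
    le_trans (mod_cast translateBoundary_mono Finset.subset_union_left B₁) hB₁K
  have hB₁K' : (translateBoundary K B₁ : ℝ) ≤ δ₁ * A.card :=
    le_trans (mod_cast translateBoundary_mono Finset.subset_union_right B₁) hB₁K
  obtain ⟨B₂, hB₂R, m, hm, hmH, hB₂c⟩ :=
    exists_almost_disjoint_translates (A \ B₁) T hT hε0 hε1
  have hRT : (translateBoundary T (A \ B₁) : ℝ) ≤ 2 * δ₁ * A.card := by
    have : (translateBoundary T (A \ B₁) : ℝ) ≤ translateBoundary T A + translateBoundary T B₁ :=
      mod_cast translateBoundary_sdiff_le T A B₁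
    linarith
  have hB₂A : B₂ ⊆ A := hB₂R.trans Finset.sdiff_subset
  have hB₂le : (B₂.card : ℝ) ≤ A.card := mod_cast Finset.card_le_card hB₂A
  have hdisj : Disjoint B₁ B₂ := Finset.disjoint_of_subset_right hB₂R Finset.disjoint_sdiff
  have hmT : (m : ℝ) * T.card ≤ B₂.card / (1 - ε) := by
    rw [le_div_iff₀ hε']; linarith
  refine ⟨B₁ ∪ B₂, Finset.union_subset hB₁A hB₂A, ?_, ?_, ?_⟩
  · have h1 := hmH H hH
    have h2 : (m : ℝ) * H T ≤ α / (1 - ε) * B₂.card :=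
      calc (m : ℝ) * H T ≤ m * (α * T.card) := by gcongr
        _ = α * (m * T.card) := by ring
        _ ≤ α * (B₂.card / (1 - ε)) := by gcongr
        _ = α / (1 - ε) * B₂.card := by ring
    have h3 := hH.union_le B₁ B₂
    rw [Finset.card_union_of_disjoint hdisj]
    push_cast
    linarith
  · have h1 : (((A \ B₁) \ B₂).card : ℝ) + B₂.card = (A \ B₁).card :=
      mod_cast Finset.card_sdiff_add_card_eq_card hB₂R
    rw [show A \ (B₁ ∪ B₂) = (A \ B₁) \ B₂ from sdiff_sdiff_left.symm]
    have h2 : ε * (translateBoundary T (A \ B₁) : ℝ) ≤ ε * (2 * (ρ / 4) * A.card) := by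
      refine mul_le_mul_of_nonneg_left (hRT.trans ?_) hε0.le
      gcongr
      exact min_le_right _ _
    have h3 := mul_le_mul_of_nonneg_left hB₁c hε'.le
    linarith
  · have h1 := hmH _ (isInvSubadditive_translateBoundary K)
    have h2 : (m : ℝ) * translateBoundary K T ≤ δ / 2 * A.card :=
      calc (m : ℝ) * translateBoundary K T ≤ m * (δ / 2 * (1 - ε) * T.card) := by gcongr
        _ = δ / 2 * ((1 - ε) * (m * T.card)) := by ring
        _ ≤ δ / 2 * B₂.card := by gcongr
        _ ≤ δ / 2 * A.card := by gcongr
    have h3 : (translateBoundary K (B₁ ∪ B₂) : ℝ) ≤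
        translateBoundary K B₁ + translateBoundary K B₂ :=
      mod_cast translateBoundary_union_le K B₁ B₂
    have h4 := mul_le_mul_of_nonneg_right (min_le_left (δ / 2) (ρ / 4)) hAc
    linarith

/-- If arbitrarily invariant nonempty finite sets `T` satisfy `H T ≤ α * #T`, then all
sufficiently invariant finite sets `A` satisfy `H A ≤ γ * #A`, for every `γ > α`. -/
theorem IsInvSubadditive.le_of_tiles {H : Finset G → ℝ} (hH : IsInvSubadditive H)
    (hH0 : 0 ≤ H {0}) {α γ : ℝ} (hα : 0 ≤ α) (hαγ : α < γ)
    (htile : ∀ (K : Finset G) (δ : ℝ), 0 < δ → ∃ T : Finset G, T.Nonempty ∧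
      translateBoundary K T ≤ δ * T.card ∧ H T ≤ α * T.card) :
    ∃ (K : Finset G) (δ : ℝ), 0 < δ ∧ ∀ A : Finset G,
      translateBoundary K A ≤ δ * A.card → H A ≤ γ * A.card := by
  obtain ⟨ε, hε0, hε1, hε⟩ : ∃ ε : ℝ, 0 < ε ∧ ε < 1 ∧ α / (1 - ε) < γ := by
    have hc : Tendsto (fun ε : ℝ => α / (1 - ε)) (nhdsWithin 0 (Set.Ioi 0)) (nhds (α / (1 - 0))) :=
      (ContinuousAt.div (by fun_prop) (by fun_prop) (by norm_num)).tendsto.mono_left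
        nhdsWithin_le_nhds
    have h1 := hc.eventually (Iio_mem_nhds (show α / (1 - 0) < γ by simpa using hαγ))
    have h2 : ∀ᶠ ε : ℝ in nhdsWithin 0 (Set.Ioi 0), ε ∈ Set.Ioo 0 1 := Ioo_mem_nhdsGT one_pos
    obtain ⟨ε, h1, h2⟩ := (h1.and h2).exists
    exact ⟨ε, h2.1, h2.2, h1⟩
  set β := α / (1 - ε)
  have hβ0 : 0 ≤ β := div_nonneg hα (by linarith)
  have hquasi : ∀ k : ℕ, HasQuasiTilings H β ((1 - ε / 2) ^ k) := by
    intro k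
    induction k with
    | zero =>
      intro K δ hδ
      refine ⟨∅, 1, one_pos, fun A _ => ⟨∅, by simp, by simp [hH.empty], by simp, ?_⟩⟩
      rw [translateBoundary_empty]
      simp; positivity
    | succ k ih =>
      rw [pow_succ']
      exact ih.refine hH hα hε0 hε1 (pow_pos (by linarith) k) htile
  obtain ⟨k, hk⟩ := exists_pow_lt_of_lt_one
    (show 0 < (γ - β) / (H {0} + 1) from div_pos (by linarith) (by linarith))
    (show 1 - ε / 2 < 1 by linarith)
  rw [lt_div_iff₀ (by linarith)] at hk
  obtain ⟨L, η, hη, hL⟩ := hquasi k ∅ 1 one_pos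
  refine ⟨L, η, hη, fun A hA => ?_⟩
  obtain ⟨B, hBA, hBH, hBc, -⟩ := hL A hA
  have h1 := hH.union_le B (A \ B)
  rw [Finset.union_sdiff_of_subset hBA] at h1
  have h2 := hH.le_card (A \ B)
  have h3 : (B.card : ℝ) ≤ A.card := mod_cast Finset.card_le_card hBA
  have h4 : H {0} * ((A \ B).card : ℝ) ≤ H {0} * ((1 - ε / 2) ^ k * A.card) := by gcongr
  have h5 : β * (B.card : ℝ) ≤ β * A.card := by gcongr
  have h6 : 0 ≤ (1 - ε / 2) ^ k := (pow_pos (by linarith) k).le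
  have h7 : (H {0} * (1 - ε / 2) ^ k) * (A.card : ℝ) ≤ (γ - β) * A.card := by
    gcongr
    linarith
  linarith

end OrnsteinWeiss

section Discretization

/-- The integer point indexing the unit square that contains `z`. -/
noncomputable def squareIndex (z : ℂ) : ℤ × ℤ := (⌊z.re⌋, ⌊z.im⌋)

lemma measurable_squareIndex : Measurable squareIndex :=
  (Int.measurable_floor.comp Complex.measurable_re).prodMk
    (Int.measurable_floor.comp Complex.measurable_im)

lemma norm_sub_le_of_squareIndex {z w : ℂ} {g : ℤ × ℤ}
    (h : squareIndex w = squareIndex z + g) : ‖w - z‖ ≤ |(g.1 : ℝ)| + |(g.2 : ℝ)| + 2 := by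
  simp only [squareIndex, Prod.ext_iff, Prod.fst_add, Prod.snd_add] at h
  have h1 : (⌊w.re⌋ : ℝ) = ⌊z.re⌋ + g.1 := mod_cast h.1
  have h2 : (⌊w.im⌋ : ℝ) = ⌊z.im⌋ + g.2 := mod_cast h.2
  refine (Complex.norm_le_abs_re_add_abs_im _).trans ?_
  have key : ∀ (x y : ℝ) (k : ℤ), (⌊y⌋ : ℝ) = ⌊x⌋ + k → |y - x| ≤ |(k : ℝ)| + 1 := by
    intro x y k hk
    have := Int.floor_le x
    have := Int.lt_floor_add_one x
    have := Int.floor_le y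
    have := Int.lt_floor_add_one y
    have := le_abs_self (k : ℝ)
    have := neg_abs_le (k : ℝ)
    rw [abs_le]
    constructor <;> linarith
  have h3 := key _ _ _ h1
  have h4 := key _ _ _ h2
  rw [Complex.sub_re, Complex.sub_im]
  linarith

/-- The union of the unit squares indexed by `F`. -/
def squareUnion (F : Finset (ℤ × ℤ)) : Set ℂ := squareIndex ⁻¹' (F : Set (ℤ × ℤ))

lemma measurableSet_squareUnion (F : Finset (ℤ × ℤ)) : MeasurableSet (squareUnion F) :=
  measurable_squareIndex F.finite_toSet.measurableSet

lemma squareUnion_union (F F' : Finset (ℤ × ℤ)) :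
    squareUnion (F ∪ F') = squareUnion F ∪ squareUnion F' := by
  simp [squareUnion]

lemma isBounded_preimage_squareIndex_singleton (v : ℤ × ℤ) :
    Bornology.IsBounded (squareIndex ⁻¹' {v}) := by
  rw [Metric.isBounded_iff]
  refine ⟨2, fun z hz w hw => ?_⟩
  rw [dist_eq_norm]
  have := norm_sub_le_of_squareIndex (z := w) (w := z) (g := 0)
    (by rw [add_zero]; exact Eq.trans hz (Eq.symm hw))
  simpa using this

lemma squareUnion_eq_biUnion (F : Finset (ℤ × ℤ)) :
    squareUnion F = ⋃ v ∈ F, squareIndex ⁻¹' {v} := by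
  ext z; simp [squareUnion]

lemma isBounded_squareUnion (F : Finset (ℤ × ℤ)) : Bornology.IsBounded (squareUnion F) := by
  rw [squareUnion_eq_biUnion]
  exact (Bornology.isBounded_biUnion_finset F).2
    fun v _ => isBounded_preimage_squareIndex_singleton v

lemma volume_preimage_squareIndex_singleton (v : ℤ × ℤ) :
    volume (squareIndex ⁻¹' {v}) = 1 := by
  have h : squareIndex ⁻¹' {v} = Complex.measurableEquivRealProd ⁻¹'
      (Set.Ico (v.1 : ℝ) (v.1 + 1) ×ˢ Set.Ico (v.2 : ℝ) (v.2 + 1)) := by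
    ext z
    simp [squareIndex, Prod.ext_iff, Int.floor_eq_iff, Complex.measurableEquivRealProd]
  rw [h, Complex.volume_preserving_equiv_real_prod.measure_preimage
    (measurableSet_Ico.prod measurableSet_Ico).nullMeasurableSet, Measure.volume_eq_prod,
    Measure.prod_prod]
  simp

lemma volume_squareUnion (F : Finset (ℤ × ℤ)) : volume (squareUnion F) = F.card := by
  rw [squareUnion_eq_biUnion, measure_biUnion_finset]
  · simp [volume_preimage_squareIndex_singleton]
  · intro v _ w _ hvw
    exact Disjoint.preimage _ (by simpa using hvw)
  · exact fun v _ => measurable_squareIndex (measurableSet_singleton v)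

lemma squareUnion_image_add (c : ℤ × ℤ) (F : Finset (ℤ × ℤ)) :
    squareUnion (F.image (c + ·)) = (fun z => (⟨c.1, c.2⟩ : ℂ) + z) '' squareUnion F := by
  rw [Set.image_add_left]
  ext z
  have h : squareIndex (-(⟨c.1, c.2⟩ : ℂ) + z) = -c + squareIndex z := by
    simp [squareIndex, Prod.ext_iff, neg_add_eq_sub]
  simp only [squareUnion, Set.mem_preimage, h, Finset.mem_coe, Finset.mem_image]
  constructor
  · rintro ⟨a, ha, h⟩
    rwa [← h, neg_add_cancel_left]
  · exact fun hz => ⟨_, hz, by simp⟩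

lemma finite_squareIndex_image {Ω : Set ℂ} (hΩ : Bornology.IsBounded Ω) :
    (squareIndex '' Ω).Finite := by
  obtain ⟨R, hR⟩ := hΩ.exists_norm_le
  refine ((Set.finite_Icc ⌊-R⌋ ⌊R⌋).prod (Set.finite_Icc ⌊-R⌋ ⌊R⌋)).subset ?_
  rintro _ ⟨z, hz, rfl⟩
  have h1 := abs_le.1 ((Complex.abs_re_le_norm z).trans (hR z hz))
  have h2 := abs_le.1 ((Complex.abs_im_le_norm z).trans (hR z hz))
  exact ⟨⟨Int.floor_mono h1.1, Int.floor_mono h1.2⟩, ⟨Int.floor_mono h2.1, Int.floor_mono h2.2⟩⟩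

/-- The indices of the unit squares that meet the bounded set `Ω`. -/
noncomputable def squareCover (Ω : Set ℂ) (hΩ : Bornology.IsBounded Ω) : Finset (ℤ × ℤ) :=
  (finite_squareIndex_image hΩ).toFinset

lemma mem_squareCover {Ω : Set ℂ} {hΩ : Bornology.IsBounded Ω} {v : ℤ × ℤ} :
    v ∈ squareCover Ω hΩ ↔ ∃ z ∈ Ω, squareIndex z = v := by
  simp [squareCover]

lemma subset_squareUnion_squareCover {Ω : Set ℂ} (hΩ : Bornology.IsBounded Ω) :
    Ω ⊆ squareUnion (squareCover Ω hΩ) :=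
  fun z hz => mem_squareCover.2 ⟨z, hz, rfl⟩

lemma isBounded_rBoundary {Ω : Set ℂ} (hΩ : Bornology.IsBounded Ω) (r : ℝ) :
    Bornology.IsBounded (rBoundary r Ω) := by
  refine (hΩ.cthickening (δ := r)).subset ?_
  rintro a ⟨⟨z, hza, hz⟩, -⟩
  exact Metric.mem_cthickening_of_dist_le a z r Ω hz (by rwa [dist_comm])

lemma card_le_volume {F : Finset (ℤ × ℤ)} {S : Set ℂ} (hS : Bornology.IsBounded S)
    (h : squareUnion F ⊆ S) : (F.card : ℝ) ≤ (volume S).toReal := by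
  have := ENNReal.toReal_mono hS.measure_lt_top.ne (measure_mono (μ := volume) h)
  simpa [volume_squareUnion] using this

lemma volume_le_card_squareCover {Ω : Set ℂ} (hΩ : Bornology.IsBounded Ω) :
    (volume Ω).toReal ≤ (squareCover Ω hΩ).card := by
  have := ENNReal.toReal_mono (by simp [volume_squareUnion])
    (measure_mono (μ := volume) (subset_squareUnion_squareCover hΩ))
  simpa [volume_squareUnion] using this

lemma mem_rBoundary_of_squareIndex {Ω : Set ℂ} {r : ℝ} {a z w : ℂ} {g g' : ℤ × ℤ}
    (hz : z ∈ Ω) (hw : w ∉ Ω) (haz : squareIndex z = squareIndex a + g)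
    (haw : squareIndex w = squareIndex a + g') (hg : |(g.1 : ℝ)| + |(g.2 : ℝ)| + 2 ≤ r)
    (hg' : |(g'.1 : ℝ)| + |(g'.2 : ℝ)| + 2 ≤ r) : a ∈ rBoundary r Ω :=
  ⟨⟨z, by simpa [dist_eq_norm] using (norm_sub_le_of_squareIndex haz).trans hg, hz⟩,
    ⟨w, by simpa [dist_eq_norm] using (norm_sub_le_of_squareIndex haw).trans hg', hw⟩⟩

lemma squareUnion_squareCover_subset {Ω : Set ℂ} (hΩ : Bornology.IsBounded Ω) :
    squareUnion (squareCover Ω hΩ) ⊆ Ω ∪ rBoundary 2 Ω := by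
  intro a ha
  obtain ⟨z, hz, hza⟩ := mem_squareCover.1 ha
  by_cases haΩ : a ∈ Ω
  · exact Or.inl haΩ
  · exact Or.inr (mem_rBoundary_of_squareIndex (g := 0) (g' := 0) hz haΩ (by simpa using hza)
      (by simp) (by simp) (by simp))

lemma card_squareCover_le {Ω : Set ℂ} (hΩ : Bornology.IsBounded Ω) :
    ((squareCover Ω hΩ).card : ℝ) ≤ (volume Ω).toReal + (volume (rBoundary 2 Ω)).toReal := by
  refine (card_le_volume (hΩ.union (isBounded_rBoundary hΩ 2))
    (squareUnion_squareCover_subset hΩ)).trans ?_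
  exact measureReal_union_le _ _

/-- The boundary of the discretization is controlled by a thick boundary of the set. -/
lemma exists_translateBoundary_squareCover_le (K : Finset (ℤ × ℤ)) :
    ∃ r > (0 : ℝ), ∀ (Ω : Set ℂ) (hΩ : Bornology.IsBounded Ω),
      (translateBoundary K (squareCover Ω hΩ) : ℝ) ≤ K.card * (volume (rBoundary r Ω)).toReal := by
  refine ⟨∑ g ∈ K, (|(g.1 : ℝ)| + |(g.2 : ℝ)|) + 2, by positivity, fun Ω hΩ => ?_⟩
  unfold translateBoundary
  push_cast
  rw [← nsmul_eq_mul]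
  refine Finset.sum_le_card_nsmul _ _ _ fun g hg => ?_
  refine card_le_volume (isBounded_rBoundary hΩ _) fun a ha => ?_
  have ha' := Finset.mem_filter.1 ha
  obtain ⟨z, hz, hza⟩ := mem_squareCover.1 ha'.1
  have hw : squareIndex (a + ⟨g.1, g.2⟩) = squareIndex a + g := by
    simp [squareIndex, Prod.ext_iff]
  refine mem_rBoundary_of_squareIndex (g := 0) (w := a + ⟨g.1, g.2⟩) (g' := g) hz
    (fun hmem => ha'.2 (mem_squareCover.2 ⟨_, hmem, hw⟩)) (by simpa using hza) hw ?_ ?_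
  · simp; positivity
  · have := Finset.single_le_sum (f := fun g : ℤ × ℤ => |(g.1 : ℝ)| + |(g.2 : ℝ)|)
      (fun _ _ => by positivity) hg
    simpa using this

/-- The squares meeting `Ω` are covered by `Ω` and the squares meeting both `Ω` and `Ωᶜ`. -/
lemma squareUnion_squareCover_eq {Ω : Set ℂ} (hΩ : Bornology.IsBounded Ω) :
    ∃ F : Finset (ℤ × ℤ), squareUnion (squareCover Ω hΩ) = Ω ∪ squareUnion F ∧
      (F.card : ℝ) ≤ (volume (rBoundary 2 Ω)).toReal := by
  classical
  refine ⟨(squareCover Ω hΩ).filter fun v => ∃ w, w ∉ Ω ∧ squareIndex w = v, ?_, ?_⟩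
  · refine Set.Subset.antisymm (fun a ha => ?_)
      (Set.union_subset (subset_squareUnion_squareCover hΩ) fun a ha => ?_)
    · by_cases haΩ : a ∈ Ω
      · exact Or.inl haΩ
      · exact Or.inr (Finset.mem_filter.2 ⟨ha, a, haΩ, rfl⟩)
    · exact (Finset.mem_filter.1 ha).1
  · refine card_le_volume (isBounded_rBoundary hΩ 2) fun a ha => ?_
    obtain ⟨ha1, w, hw, hwa⟩ := Finset.mem_filter.1 ha
    obtain ⟨z, hz, hza⟩ := mem_squareCover.1 ha1
    exact mem_rBoundary_of_squareIndex (g := 0) (g' := 0) hz hw (by simpa using hza)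
      (by simpa using hwa) (by simp) (by simp)

end Discretization

section SetFunction

/-- A nonnegative, monotone, subadditive and translation invariant function of bounded Borel
subsets of `ℂ`. -/
structure IsInvSubadditiveBorel (h : Set ℂ → ℝ) : Prop where
  nonneg : ∀ Ω : Set ℂ, Bornology.IsBounded Ω → MeasurableSet Ω → 0 ≤ h Ω
  mono : ∀ Ω₁ Ω₂ : Set ℂ, Bornology.IsBounded Ω₁ → MeasurableSet Ω₁ →
    Bornology.IsBounded Ω₂ → MeasurableSet Ω₂ → Ω₁ ⊆ Ω₂ → h Ω₁ ≤ h Ω₂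
  union_le : ∀ Ω₁ Ω₂ : Set ℂ, Bornology.IsBounded Ω₁ → MeasurableSet Ω₁ →
    Bornology.IsBounded Ω₂ → MeasurableSet Ω₂ → h (Ω₁ ∪ Ω₂) ≤ h Ω₁ + h Ω₂
  image_add : ∀ (a : ℂ) (Ω : Set ℂ), Bornology.IsBounded Ω → MeasurableSet Ω →
    h ((fun z => a + z) '' Ω) = h Ω

/-- The set function induced on finite unions of unit squares, normalized to vanish on `∅`. -/
noncomputable def discretize (h : Set ℂ → ℝ) (F : Finset (ℤ × ℤ)) : ℝ :=
  if F = ∅ then 0 else h (squareUnion F)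

variable {h : Set ℂ → ℝ}

namespace IsInvSubadditiveBorel

lemma discretize_nonneg (hh : IsInvSubadditiveBorel h) (F : Finset (ℤ × ℤ)) :
    0 ≤ discretize h F := by
  unfold discretize
  split_ifs
  · exact le_rfl
  · exact hh.nonneg _ (isBounded_squareUnion F) (measurableSet_squareUnion F)

lemma isInvSubadditive_discretize (hh : IsInvSubadditiveBorel h) :
    IsInvSubadditive (discretize h) where
  empty := by simp [discretize]
  union_le A B := by
    rcases A.eq_empty_or_nonempty with rfl | hA
    · simp [discretize]
    rcases B.eq_empty_or_nonempty with rfl | hB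
    · simp [discretize]
    rw [discretize, discretize, discretize, if_neg (hA.mono Finset.subset_union_left).ne_empty,
      if_neg hA.ne_empty, if_neg hB.ne_empty, squareUnion_union]
    exact hh.union_le _ _ (isBounded_squareUnion A) (measurableSet_squareUnion A)
      (isBounded_squareUnion B) (measurableSet_squareUnion B)
  image_add c A := by
    simp only [discretize, Finset.image_eq_empty, squareUnion_image_add,
      hh.image_add _ _ (isBounded_squareUnion A) (measurableSet_squareUnion A)]

lemma le_discretize (hh : IsInvSubadditiveBorel h) {Ω : Set ℂ} (hΩ : Bornology.IsBounded Ω)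
    (hm : MeasurableSet Ω) (hne : Ω.Nonempty) : h Ω ≤ discretize h (squareCover Ω hΩ) := by
  obtain ⟨z, hz⟩ := hne
  rw [discretize, if_neg (Finset.ne_empty_of_mem (mem_squareCover.2 ⟨z, hz, rfl⟩))]
  exact hh.mono _ _ hΩ hm (isBounded_squareUnion _) (measurableSet_squareUnion _)
    (subset_squareUnion_squareCover hΩ)

lemma discretize_le (hh : IsInvSubadditiveBorel h) {Ω : Set ℂ} (hΩ : Bornology.IsBounded Ω)
    (hm : MeasurableSet Ω) :
    discretize h (squareCover Ω hΩ) ≤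
      h Ω + discretize h {0} * (volume (rBoundary 2 Ω)).toReal := by
  have h0 := hh.discretize_nonneg {0}
  have hΩ0 := hh.nonneg Ω hΩ hm
  have hprod : 0 ≤ discretize h {0} * (volume (rBoundary 2 Ω)).toReal := by positivity
  obtain ⟨F, hF, hFc⟩ := squareUnion_squareCover_eq hΩ
  rw [discretize]
  split_ifs
  · linarith
  rw [hF]
  rcases F.eq_empty_or_nonempty with rfl | hFne
  · simp only [squareUnion, Finset.coe_empty, Set.preimage_empty, Set.union_empty]
    linarith
  refine (hh.union_le _ _ hΩ hm (isBounded_squareUnion F) (measurableSet_squareUnion F)).trans ?_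
  gcongr
  have h1 := hh.isInvSubadditive_discretize.le_card F
  rw [discretize, if_neg hFne.ne_empty] at h1
  exact h1.trans (by gcongr)

end IsInvSubadditiveBorel

lemma IsFolner.eventually_rBoundary_le {Ω : ℕ → Set ℂ} (hΩ : IsFolner Ω) {r : ℝ} (hr : 0 < r)
    {ε : ℝ} (hε : 0 < ε) (C : ℝ) :
    ∀ᶠ n in atTop, C * (volume (rBoundary r (Ω n))).toReal ≤ ε * (volume (Ω n)).toReal := by
  have h1 := (hΩ.2.2.2 r hr).const_mul C
  rw [mul_zero] at h1
  filter_upwards [h1.eventually (Iio_mem_nhds hε)] with n hn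
  have hpos := hΩ.2.2.1 n
  rw [← mul_div_assoc, div_lt_iff₀ hpos] at hn
  exact hn.le

lemma IsFolner.nonempty {Ω : ℕ → Set ℂ} (hΩ : IsFolner Ω) (n : ℕ) : (Ω n).Nonempty := by
  by_contra! h
  have := hΩ.2.2.1 n
  simp [h] at this

lemma IsFolner.eventually_translateBoundary_le {Ω : ℕ → Set ℂ} (hΩ : IsFolner Ω)
    (K : Finset (ℤ × ℤ)) {δ : ℝ} (hδ : 0 < δ) :
    ∀ᶠ n in atTop, (translateBoundary K (squareCover (Ω n) (hΩ.1 n)) : ℝ) ≤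
      δ * (squareCover (Ω n) (hΩ.1 n)).card := by
  obtain ⟨r, hr, hK⟩ := exists_translateBoundary_squareCover_le K
  filter_upwards [hΩ.eventually_rBoundary_le hr hδ K.card] with n hn
  refine (hK _ (hΩ.1 n)).trans (hn.trans ?_)
  gcongr
  exact volume_le_card_squareCover _

/-- If `h` has density below `α` infinitely often along one Følner sequence, then its density is
eventually at most `γ` along any other one, for every `γ > α`. -/
lemma IsInvSubadditiveBorel.eventually_le_of_frequently_lt (hh : IsInvSubadditiveBorel h)
    {Ω Ω' : ℕ → Set ℂ} (hΩ : IsFolner Ω) (hΩ' : IsFolner Ω') {α γ : ℝ} (hαγ : α < γ)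
    (hfreq : ∃ᶠ n in atTop, h (Ω n) / (volume (Ω n)).toReal < α) :
    ∀ᶠ n in atTop, h (Ω' n) / (volume (Ω' n)).toReal ≤ γ := by
  have hα : 0 ≤ α := by
    obtain ⟨n, hn⟩ := hfreq.exists
    exact (div_nonneg (hh.nonneg _ (hΩ.1 n) (hΩ.2.1 n)) (hΩ.2.2.1 n).le).trans hn.le
  obtain ⟨α', hαα', hα'γ⟩ := exists_between hαγ
  obtain ⟨γ', hα'γ', hγ'γ⟩ := exists_between hα'γ
  obtain ⟨K, δ, hδ, hK⟩ := hh.isInvSubadditive_discretize.le_of_tiles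
    (hh.discretize_nonneg _) (hα.trans hαα'.le) hα'γ' (fun K δ hδ => by
      obtain ⟨n, hn, hb, hK⟩ := (hfreq.and_eventually
        ((hΩ.eventually_rBoundary_le two_pos (sub_pos.2 hαα') (discretize h {0})).and
          (hΩ.eventually_translateBoundary_le K hδ))).exists
      obtain ⟨z, hz⟩ := hΩ.nonempty n
      refine ⟨_, ⟨_, mem_squareCover.2 ⟨z, hz, rfl⟩⟩, hK, ?_⟩
      rw [div_lt_iff₀ (hΩ.2.2.1 n)] at hn
      calc discretize h (squareCover (Ω n) (hΩ.1 n))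
          ≤ α' * (volume (Ω n)).toReal := by
            linarith [hh.discretize_le (hΩ.1 n) (hΩ.2.1 n)]
        _ ≤ α' * (squareCover (Ω n) (hΩ.1 n)).card :=
            mul_le_mul_of_nonneg_left (volume_le_card_squareCover _) (hα.trans hαα'.le))
  have hγ'0 : 0 ≤ γ' := hα.trans (hαα'.trans hα'γ').le
  filter_upwards [hΩ'.eventually_translateBoundary_le K hδ,
    hΩ'.eventually_rBoundary_le two_pos (sub_pos.2 hγ'γ) γ'] with n hn hb
  rw [div_le_iff₀ (hΩ'.2.2.1 n)]
  have h1 := mul_le_mul_of_nonneg_left (card_squareCover_le (hΩ'.1 n)) hγ'0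
  linarith [hh.le_discretize (hΩ'.1 n) (hΩ'.2.1 n) (hΩ'.nonempty n), hK _ hn]

lemma IsInvSubadditiveBorel.exists_tendsto (hh : IsInvSubadditiveBorel h) {Ω : ℕ → Set ℂ}
    (hΩ : IsFolner Ω) :
    ∃ L : ℝ, Tendsto (fun n => h (Ω n) / (volume (Ω n)).toReal) atTop (nhds L) := by
  refine tendsto_of_no_upcrossings dense_univ ?_ ?_ ?_
  · rintro a - b - hab ⟨ha, hb⟩
    obtain ⟨n, hn, hn'⟩ := (hb.and_eventually
      (hh.eventually_le_of_frequently_lt hΩ hΩ hab ha)).exists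
    exact hn.not_ge hn'
  · refine isBoundedUnder_of_eventually_le (a := discretize h {0} + 1) ?_
    filter_upwards [hΩ.eventually_rBoundary_le two_pos one_pos (discretize h {0})] with n hb
    rw [div_le_iff₀ (hΩ.2.2.1 n)]
    have h1 := mul_le_mul_of_nonneg_left (card_squareCover_le (hΩ.1 n))
      (hh.discretize_nonneg {0})
    linarith [hh.le_discretize (hΩ.1 n) (hΩ.2.1 n) (hΩ.nonempty n),
      hh.isInvSubadditive_discretize.le_card (squareCover (Ω n) (hΩ.1 n))]
  · exact isBoundedUnder_of_eventually_ge (a := 0) (Eventually.of_forall fun n =>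
      div_nonneg (hh.nonneg _ (hΩ.1 n) (hΩ.2.1 n)) (hΩ.2.2.1 n).le)

lemma IsInvSubadditiveBorel.limit_le (hh : IsInvSubadditiveBorel h) {Ω Ω' : ℕ → Set ℂ}
    (hΩ : IsFolner Ω) (hΩ' : IsFolner Ω') {L L' : ℝ}
    (hL : Tendsto (fun n => h (Ω n) / (volume (Ω n)).toReal) atTop (nhds L))
    (hL' : Tendsto (fun n => h (Ω' n) / (volume (Ω' n)).toReal) atTop (nhds L')) :
    L' ≤ L := by
  refine le_of_forall_gt_imp_ge_of_dense fun γ hγ => ?_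
  obtain ⟨α, hLα, hαγ⟩ := exists_between hγ
  exact le_of_tendsto hL' (hh.eventually_le_of_frequently_lt hΩ hΩ' hαγ
    (hL.eventually (Iio_mem_nhds hLα)).frequently)

end SetFunction

theorem stmt_4 (h : Set ℂ → ℝ)
    (hnonneg : ∀ Ω : Set ℂ, Bornology.IsBounded Ω → MeasurableSet Ω → 0 ≤ h Ω)
    (hmono : ∀ Ω₁ Ω₂ : Set ℂ, Bornology.IsBounded Ω₁ → MeasurableSet Ω₁ →
      Bornology.IsBounded Ω₂ → MeasurableSet Ω₂ → Ω₁ ⊆ Ω₂ → h Ω₁ ≤ h Ω₂)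
    (hsub : ∀ Ω₁ Ω₂ : Set ℂ, Bornology.IsBounded Ω₁ → MeasurableSet Ω₁ →
      Bornology.IsBounded Ω₂ → MeasurableSet Ω₂ → h (Ω₁ ∪ Ω₂) ≤ h Ω₁ + h Ω₂)
    (hinv : ∀ (a : ℂ) (Ω : Set ℂ), Bornology.IsBounded Ω → MeasurableSet Ω →
      h ((fun z => a + z) '' Ω) = h Ω) :
    (∀ Ω : ℕ → Set ℂ, IsFolner Ω →
      ∃ L : ℝ, Tendsto (fun n => h (Ω n) / (volume (Ω n)).toReal) atTop (nhds L)) ∧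
    (∀ Ω Ω' : ℕ → Set ℂ, IsFolner Ω → IsFolner Ω' → ∀ L L' : ℝ,
      Tendsto (fun n => h (Ω n) / (volume (Ω n)).toReal) atTop (nhds L) →
      Tendsto (fun n => h (Ω' n) / (volume (Ω' n)).toReal) atTop (nhds L') →
      L = L') := by
  have hh : IsInvSubadditiveBorel h := ⟨hnonneg, hmono, hsub, hinv⟩
  exact ⟨fun Ω hΩ => hh.exists_tendsto hΩ, fun Ω Ω' hΩ hΩ' L L' hL hL' =>
    le_antisymm (hh.limit_le hΩ' hΩ hL' hL) (hh.limit_le hΩ hΩ' hL hL')⟩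
end
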